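/- Let x, z ∈ ℝ, y < 0, and ℓ = (ℓ₁, ℓ₂, ℓ₃) ∈ ℝ³. Define ϖ∘(τ,ℓ) = ℓ₂(2τ²-2τ+1) + i(ℓ₁(1-τ) + ℓ₃τ)√(2τ²-2τ+1) for τ ∈ [0,1] (so that ϖ∘(τ,ℓ) = (1-τ)² ϖ(τ/(1-τ),ℓ₁,ℓ₂,ℓ₃) for τ ∈ [0,1) and ϖ∘(1,ℓ) = ℓ₂ + iℓ₃), and define Φ_ℓ(τ) = (τ-1) e^{Λ(τ,x,y,z)} ∫_τ¹ ϖ∘(θ,ℓ) e^{-Λ(θ,x,y,z)}/(θ-1)⁴ dθ for τ ∈ [0,1). Then Φ_ℓ(τ) tends to (ℓ₂ + iℓ₃)/(2(y+iz)) as τ → 1⁻ with rate O(1-τ): there exist C ≥ 0 and δ ∈ (0,1) such that |Φ_ℓ(τ) - (ℓ₂+iℓ₃)/(2(y+iz))| ≤ C(1-τ) for all τ ∈ (1-δ,1). -/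

import Mathlib

open MeasureTheory Set

noncomputable def wLam (τ x y z : ℝ) : ℂ :=
  -(((τ : ℂ) - 1) ^ 2)⁻¹ * ((y : ℂ) + Complex.I * (z : ℂ) * ((τ * Real.sqrt (2 * τ ^ 2 - 2 * τ + 1) : ℝ) : ℂ))
    - ((τ : ℂ) - 1)⁻¹ * (2 * (y : ℂ) - Complex.I * (x : ℂ) * ((Real.sqrt (2 * τ ^ 2 - 2 * τ + 1) : ℝ) : ℂ))

noncomputable def wPhaseCirc (τ l₁ l₂ l₃ : ℝ) : ℂ :=
  (l₂ * (2 * τ ^ 2 - 2 * τ + 1) : ℝ) +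
    Complex.I * ((l₁ * (1 - τ) + l₃ * τ : ℝ) : ℂ) * ((Real.sqrt (2 * τ ^ 2 - 2 * τ + 1) : ℝ) : ℂ)

noncomputable def wPhiL (τ x y z l₁ l₂ l₃ : ℝ) : ℂ :=
  ((τ : ℂ) - 1) * Complex.exp (wLam τ x y z) *
    ∫ θ in τ..1, wPhaseCirc θ l₁ l₂ l₃ * Complex.exp (-(wLam θ x y z)) / ((θ : ℂ) - 1) ^ 4

open Filter Topology

/-- The norm of `exp (-(wLam τ x y z))`. -/
noncomputable def wDecay (y τ : ℝ) : ℝ :=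
  Real.exp (y * (((τ - 1) ^ 2)⁻¹ + 2 * (τ - 1)⁻¹))

/-- The derivative of `wLam` with respect to `τ`. -/
noncomputable def wLamDeriv (τ x y z : ℝ) : ℂ :=
  2 * (((τ : ℂ) - 1) ^ 3)⁻¹ *
      ((y : ℂ) + Complex.I * (z : ℂ) * ((τ * Real.sqrt (2 * τ ^ 2 - 2 * τ + 1) : ℝ) : ℂ))
    - (((τ : ℂ) - 1) ^ 2)⁻¹ * (Complex.I * (z : ℂ) *
        ((Real.sqrt (2 * τ ^ 2 - 2 * τ + 1) +
          τ * ((2 * τ - 1) / Real.sqrt (2 * τ ^ 2 - 2 * τ + 1)) : ℝ) : ℂ))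
    + (((τ : ℂ) - 1) ^ 2)⁻¹ *
        (2 * (y : ℂ) - Complex.I * (x : ℂ) * ((Real.sqrt (2 * τ ^ 2 - 2 * τ + 1) : ℝ) : ℂ))
    + ((τ : ℂ) - 1)⁻¹ * (Complex.I * (x : ℂ) *
        (((2 * τ - 1) / Real.sqrt (2 * τ ^ 2 - 2 * τ + 1) : ℝ) : ℂ))

lemma norm_exp_neg_wLam (τ x y z : ℝ) : ‖Complex.exp (-(wLam τ x y z))‖ = wDecay y τ := by
  rw [Complex.norm_exp, wDecay]
  congr 1
  have h1 : (((τ : ℂ) - 1) ^ 2)⁻¹ = ((((τ - 1) ^ 2)⁻¹ : ℝ) : ℂ) := by push_cast; rfl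
  have h2 : ((τ : ℂ) - 1)⁻¹ = (((τ - 1)⁻¹ : ℝ) : ℂ) := by push_cast; rfl
  rw [wLam, h1, h2, ← Complex.ofReal_neg]
  simp only [Complex.neg_re, Complex.sub_re, Complex.add_re, Complex.mul_re,
    Complex.ofReal_re, Complex.ofReal_im, Complex.I_re, Complex.I_im, Complex.mul_im,
    Complex.re_ofNat, Complex.im_ofNat]
  ring

lemma sqrt_arg_pos (τ : ℝ) : 0 < 2 * τ ^ 2 - 2 * τ + 1 := by nlinarith [sq_nonneg (2 * τ - 1)]

lemma hasDerivAt_sqrt_arg (τ : ℝ) :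
    HasDerivAt (fun t : ℝ => Real.sqrt (2 * t ^ 2 - 2 * t + 1))
      ((2 * τ - 1) / Real.sqrt (2 * τ ^ 2 - 2 * τ + 1)) τ := by
  have h : HasDerivAt (fun t : ℝ => 2 * t ^ 2 - 2 * t + 1) (2 * (2 * τ) - 2) τ := by
    have := ((((hasDerivAt_id τ).pow 2).const_mul 2).sub ((hasDerivAt_id τ).const_mul 2)).add_const
      (1 : ℝ)
    exact this.congr_deriv (by simp)
  convert h.sqrt (sqrt_arg_pos τ).ne' using 1
  have := (Real.sqrt_pos.2 (sqrt_arg_pos τ)).ne'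
  field_simp

lemma hasDerivAt_wLam {τ : ℝ} (hτ : τ ≠ 1) (x y z : ℝ) :
    HasDerivAt (fun t => wLam t x y z) (wLamDeriv τ x y z) τ := by
  have hw : (τ : ℂ) - 1 ≠ 0 := sub_ne_zero.2 (by exact_mod_cast hτ)
  have hS := (hasDerivAt_sqrt_arg τ).ofReal_comp
  have hτS := ((hasDerivAt_id τ).mul (hasDerivAt_sqrt_arg τ)).ofReal_comp
  have hsub : HasDerivAt (fun t : ℝ => (t : ℂ) - 1) 1 τ := by
    simpa using (hasDerivAt_id τ).ofReal_comp.sub_const (1 : ℂ)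
  have hinv := hsub.inv hw
  have hinv2 := (hsub.pow 2).inv (pow_ne_zero 2 hw)
  have h := (hinv2.neg.mul ((hτS.const_mul (Complex.I * (z : ℂ))).const_add (y : ℂ))).sub
    (hinv.mul ((hS.const_mul (Complex.I * (x : ℂ))).const_sub (2 * (y : ℂ))))
  refine h.congr_deriv ?_
  simp only [wLamDeriv, Pi.mul_apply, Pi.pow_apply, Pi.neg_apply, Pi.inv_apply, id]
  push_cast
  field_simp
  ring

lemma hasDerivAt_wDecay {τ : ℝ} (hτ : τ ≠ 1) (y : ℝ) :
    HasDerivAt (wDecay y)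
      (wDecay y τ * (y * (-2 * ((τ - 1) ^ 3)⁻¹ - 2 * ((τ - 1) ^ 2)⁻¹))) τ := by
  have hw : τ - 1 ≠ 0 := sub_ne_zero.2 hτ
  have hsub : HasDerivAt (fun t : ℝ => t - 1) 1 τ := (hasDerivAt_id τ).sub_const 1
  have h := (((hsub.pow 2).inv (pow_ne_zero 2 hw)).add ((hsub.inv hw).const_mul 2)).const_mul y
  refine h.exp.congr_deriv ?_
  simp only [wDecay, Pi.add_apply, Pi.pow_apply, Pi.inv_apply]
  field_simp
  ring

lemma wDecay_le {y τ : ℝ} (hy : y < 0) (h1 : 3 / 4 < τ) (h2 : τ < 1) :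
    wDecay y τ ≤ 8 / y ^ 2 * (1 - τ) ^ 4 := by
  obtain ⟨s, rfl⟩ : ∃ s, τ = 1 - s := ⟨1 - τ, by ring⟩
  have hs : 0 < s := by linarith
  have hs' : s < 1 / 4 := by linarith
  set v := -y / (2 * s ^ 2) with hv
  have hv0 : 0 < v := div_pos (by linarith) (by positivity)
  have hle : y * (((1 - s - 1) ^ 2)⁻¹ + 2 * (1 - s - 1)⁻¹) ≤ -v := by
    have : -v - y * (((1 - s - 1) ^ 2)⁻¹ + 2 * (1 - s - 1)⁻¹) = -y * (1 / 2 - 2 * s) / s ^ 2 := by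
      rw [hv, show 1 - s - 1 = -s by ring]
      field_simp
      ring
    have h0 : 0 ≤ -y * (1 / 2 - 2 * s) / s ^ 2 :=
      div_nonneg (mul_nonneg (by linarith) (by linarith)) (by positivity)
    linarith
  have hq := Real.quadratic_le_exp_of_nonneg hv0.le
  calc wDecay y (1 - s) ≤ Real.exp (-v) := Real.exp_le_exp.2 hle
    _ = (Real.exp v)⁻¹ := Real.exp_neg v
    _ ≤ (v ^ 2 / 2)⁻¹ := by gcongr; linarith
    _ = 8 / y ^ 2 * (1 - (1 - s)) ^ 4 := by
      rw [hv]
      have := hy.ne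
      field_simp
      ring

lemma wDecay_nonneg (y τ : ℝ) : 0 ≤ wDecay y τ := (Real.exp_pos _).le

lemma measurable_wDecay (y : ℝ) : Measurable (wDecay y) := by
  unfold wDecay; fun_prop

lemma measurable_wLam (x y z : ℝ) : Measurable fun t => wLam t x y z := by
  unfold wLam; fun_prop

lemma measurable_wLamDeriv (x y z : ℝ) : Measurable fun t => wLamDeriv t x y z := by
  unfold wLamDeriv; fun_prop

lemma measurable_wPhaseCirc (l₁ l₂ l₃ : ℝ) : Measurable fun t => wPhaseCirc t l₁ l₂ l₃ := by
  unfold wPhaseCirc; fun_prop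

lemma intervalIntegrable_of_norm_le_on_Ioo {E : Type*} [NormedAddCommGroup E] {f : ℝ → E}
    {a b C : ℝ} (hab : a ≤ b) (hf : AEStronglyMeasurable f)
    (h : ∀ t ∈ Ioo a b, ‖f t‖ ≤ C) : IntervalIntegrable f volume a b := by
  rw [intervalIntegrable_iff_integrableOn_Ioo_of_le hab]
  refine Measure.integrableOn_of_bounded (M := C) (by simp) hf ?_
  exact (ae_restrict_iff' measurableSet_Ioo).2 (ae_of_all _ h)

lemma tendsto_wDecay_mul_inv {y : ℝ} (hy : y < 0) :
    Tendsto (fun t => wDecay y t * (1 - t)⁻¹) (𝓝[<] 1) (𝓝 0) := by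
  have hlim : Tendsto (fun t : ℝ => 8 / y ^ 2 * (1 - t) ^ 3) (𝓝[<] 1) (𝓝 0) := by
    have : Continuous fun t : ℝ => 8 / y ^ 2 * (1 - t) ^ 3 := by fun_prop
    simpa using (this.tendsto 1).mono_left nhdsWithin_le_nhds
  have hmem : Ioo (3 / 4 : ℝ) 1 ∈ 𝓝[<] (1 : ℝ) := Ioo_mem_nhdsLT (by norm_num)
  refine squeeze_zero' ?_ ?_ hlim
  · filter_upwards [hmem] with t ht
    have : 0 < 1 - t := by linarith [ht.2]
    exact mul_nonneg (wDecay_nonneg _ _) (by positivity)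
  · filter_upwards [hmem] with t ht
    have h0 : 0 < 1 - t := by linarith [ht.2]
    rw [← div_eq_mul_inv, div_le_iff₀ h0]
    calc _ ≤ _ := wDecay_le hy ht.1 ht.2
      _ = _ := by ring

lemma tendsto_wDecay {y : ℝ} (hy : y < 0) : Tendsto (wDecay y) (𝓝[<] 1) (𝓝 0) := by
  have h1 : Tendsto (fun t : ℝ => 1 - t) (𝓝[<] 1) (𝓝 0) := by
    have : Continuous fun t : ℝ => 1 - t := by fun_prop
    simpa using (this.tendsto 1).mono_left nhdsWithin_le_nhds
  have h := (tendsto_wDecay_mul_inv hy).mul h1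
  rw [mul_zero] at h
  refine h.congr' ?_
  filter_upwards [self_mem_nhdsWithin] with t ht
  have : 1 - t ≠ 0 := (sub_pos.2 ht).ne'
  rw [mul_assoc, inv_mul_cancel₀ this, mul_one]

/-- A function bounded on `(τ, 1)` by `C * wDecay y t / (1 - t) ^ 4` is integrable. -/
lemma intervalIntegrable_of_norm_le_wDecay {E : Type*} [NormedAddCommGroup E] {f : ℝ → E}
    {y τ C : ℝ} (hy : y < 0) (h1 : 3 / 4 < τ) (h2 : τ < 1) (hC : 0 ≤ C)
    (hf : AEStronglyMeasurable f)
    (h : ∀ t ∈ Ioo τ 1, ‖f t‖ ≤ C * (wDecay y t * ((1 - t) ^ 4)⁻¹)) :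
    IntervalIntegrable f volume τ 1 := by
  refine intervalIntegrable_of_norm_le_on_Ioo (C := C * (8 / y ^ 2)) h2.le hf fun t ht => ?_
  refine (h t ht).trans (mul_le_mul_of_nonneg_left ?_ hC)
  have h0 : 0 < 1 - t := by linarith [ht.2]
  rw [← div_eq_mul_inv, div_le_iff₀ (by positivity)]
  exact wDecay_le hy (h1.trans ht.1) ht.2

lemma intervalIntegrable_wDecay_mul {y τ : ℝ} (hy : y < 0) (h1 : 3 / 4 < τ) (h2 : τ < 1) :
    IntervalIntegrable (fun t => wDecay y t * ((1 - t) ^ 3)⁻¹) volume τ 1 := by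
  refine intervalIntegrable_of_norm_le_wDecay hy h1 h2 zero_le_one
    ((measurable_wDecay y).mul (by fun_prop)).aestronglyMeasurable fun t ht => ?_
  have h0 : 0 < 1 - t := by linarith [ht.2]
  have h0' : 1 - t ≤ 1 := by linarith [ht.1]
  have := wDecay_nonneg y t
  rw [Real.norm_of_nonneg (by positivity), one_mul]
  gcongr wDecay y t * ?_
  exact inv_anti₀ (by positivity) (pow_le_pow_of_le_one h0.le h0' (by norm_num))

lemma integral_wDecay_mul_le {y τ : ℝ} (hy : y < 0) (h1 : 3 / 4 < τ) (h2 : τ < 1) :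
    ∫ t in τ..1, wDecay y t * ((1 - t) ^ 3)⁻¹ ≤ wDecay y τ / (-y) := by
  have hpt : ∀ t ∈ Ioo τ 1, wDecay y t * (y * (-2 * ((t - 1) ^ 3)⁻¹ - 2 * ((t - 1) ^ 2)⁻¹)) =
      2 * t * y * (wDecay y t * ((1 - t) ^ 3)⁻¹) := by
    intro t ht
    have h0 : 1 - t ≠ 0 := by linarith [ht.2]
    rw [show t - 1 = -(1 - t) by ring]
    field_simp
    ring
  have hint := intervalIntegrable_wDecay_mul hy h1 h2
  have hint' : IntervalIntegrable
      (fun t => 2 * t * y * (wDecay y t * ((1 - t) ^ 3)⁻¹)) volume τ 1 :=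
    hint.continuousOn_mul (by fun_prop)
  have hftc := intervalIntegral.integral_eq_sub_of_hasDerivAt_of_tendsto h2 (f := wDecay y)
    (f' := fun t => 2 * t * y * (wDecay y t * ((1 - t) ^ 3)⁻¹))
    (fun t ht => (hasDerivAt_wDecay ht.2.ne y).congr_deriv (hpt t ht)) hint'
    ((hasDerivAt_wDecay h2.ne y).continuousAt.tendsto.mono_left nhdsWithin_le_nhds)
    (tendsto_wDecay hy)
  rw [le_div_iff₀ (by linarith), mul_comm, ← intervalIntegral.integral_const_mul]
  calc ∫ t in τ..1, -y * (wDecay y t * ((1 - t) ^ 3)⁻¹)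
      ≤ ∫ t in τ..1, -(2 * t * y * (wDecay y t * ((1 - t) ^ 3)⁻¹)) := by
        refine intervalIntegral.integral_mono_on_of_le_Ioo h2.le (hint.const_mul _) hint'.neg
          fun t ht => ?_
        have h0 : 0 < 1 - t := by linarith [ht.2]
        have := wDecay_nonneg y t
        have hE : 0 ≤ wDecay y t * ((1 - t) ^ 3)⁻¹ := by positivity
        have : 0 ≤ (-y) * (2 * t - 1) := mul_nonneg (by linarith) (by linarith [ht.1])
        nlinarith
    _ = wDecay y τ := by rw [intervalIntegral.integral_neg, hftc]; ring

/-- `√(2τ²-2τ+1)` lies within `1 - τ` of its value at `τ = 1`. -/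
lemma exists_sqrt_arg_eq {τ : ℝ} (h1 : 3 / 4 < τ) (h2 : τ < 1) :
    ∃ q ∈ Icc (-1 : ℝ) 1, Real.sqrt (2 * τ ^ 2 - 2 * τ + 1) = 1 + q * (τ - 1) := by
  have hw : τ - 1 < 0 := by linarith
  have hle : Real.sqrt (2 * τ ^ 2 - 2 * τ + 1) ≤ 1 := by
    rw [Real.sqrt_le_one]; nlinarith
  have hge : τ ≤ Real.sqrt (2 * τ ^ 2 - 2 * τ + 1) := by
    apply Real.le_sqrt_of_sq_le; nlinarith [sq_nonneg (τ - 1)]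
  refine ⟨(Real.sqrt (2 * τ ^ 2 - 2 * τ + 1) - 1) / (τ - 1), ⟨?_, ?_⟩, ?_⟩
  · rw [le_div_iff_of_neg hw]; linarith
  · rw [div_le_iff_of_neg hw]; linarith
  · rw [div_mul_cancel₀ _ hw.ne]; ring

lemma sqrt_arg_deriv_mem {τ : ℝ} (h1 : 3 / 4 < τ) (h2 : τ < 1) :
    (2 * τ - 1) / Real.sqrt (2 * τ ^ 2 - 2 * τ + 1) ∈ Icc (-1 : ℝ) 1 := by
  have hge : τ ≤ Real.sqrt (2 * τ ^ 2 - 2 * τ + 1) := by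
    apply Real.le_sqrt_of_sq_le; nlinarith [sq_nonneg (τ - 1)]
  have hpos := Real.sqrt_pos.2 (sqrt_arg_pos τ)
  constructor
  · rw [le_div_iff₀ hpos]; linarith
  · rw [div_le_iff₀ hpos]; linarith

lemma exists_bound_on_cube (f : ℝ × ℝ × ℝ → ℂ) (hf : Continuous f) :
    ∃ K, 0 ≤ K ∧ ∀ w ∈ Icc (-1 : ℝ) 1, ∀ q ∈ Icc (-1 : ℝ) 1, ∀ r ∈ Icc (-1 : ℝ) 1,
      ‖f (w, q, r)‖ ≤ K := by
  obtain ⟨K, hK⟩ := (isCompact_Icc.prod (isCompact_Icc.prod isCompact_Icc) :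
    IsCompact (Icc (-1 : ℝ) 1 ×ˢ Icc (-1 : ℝ) 1 ×ˢ Icc (-1 : ℝ) 1)).exists_bound_of_continuousOn
    hf.continuousOn
  exact ⟨max K 0, le_max_right _ _, fun w hw q hq r hr =>
    (hK (w, q, r) ⟨hw, hq, hr⟩).trans (le_max_left _ _)⟩

lemma exists_bound_wPhaseCirc (l₁ l₂ l₃ : ℝ) :
    ∃ K, 0 ≤ K ∧ ∀ t ∈ Ioo (3 / 4 : ℝ) 1, ‖wPhaseCirc t l₁ l₂ l₃‖ ≤ K := by
  have hc : Continuous fun t => wPhaseCirc t l₁ l₂ l₃ := by unfold wPhaseCirc; fun_prop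
  obtain ⟨K, hK⟩ := (isCompact_Icc (a := (3 / 4 : ℝ)) (b := 1)).exists_bound_of_continuousOn
    hc.continuousOn
  exact ⟨max K 0, le_max_right _ _, fun t ht =>
    (hK t (Ioo_subset_Icc_self ht)).trans (le_max_left _ _)⟩

/-- The leading parts of `c Λ'` and `ϖ∘ / (1-t)³` cancel when `2 c (y + iz) = ϖ∘(1, ℓ)`. -/
lemma exists_bound_remainder (x y z l₁ l₂ l₃ : ℝ) (c : ℂ)
    (hc : 2 * c * ((y : ℂ) + Complex.I * z) = l₂ + Complex.I * l₃) :
    ∃ K, 0 ≤ K ∧ ∀ t ∈ Ioo (3 / 4 : ℝ) 1,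
      ‖c * wLamDeriv t x y z * ((t : ℂ) - 1)⁻¹ + c * (((t : ℂ) - 1) ^ 2)⁻¹ -
        wPhaseCirc t l₁ l₂ l₃ / ((t : ℂ) - 1) ^ 4‖ ≤ K * ((1 - t) ^ 3)⁻¹ := by
  obtain ⟨K, hK0, hK⟩ := exists_bound_on_cube (fun p : ℝ × ℝ × ℝ =>
    2 * c * Complex.I * z * (p.2.1 + 1 + p.1 * p.2.1) - l₂ * (2 + 2 * p.1)
      - Complex.I * (-l₁ * (1 + p.2.1 * p.1) + l₃ * (p.2.1 + 1 + p.1 * p.2.1))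
      + c * (-Complex.I * z * (1 + p.2.1 * p.1 + (1 + p.1) * p.2.2) + 2 * y
        - Complex.I * x * (1 + p.2.1 * p.1))
      + c * p.1 * Complex.I * x * p.2.2 + c * p.1) (by fun_prop)
  refine ⟨K, hK0, fun t ht => ?_⟩
  obtain ⟨q, hq, hS⟩ := exists_sqrt_arg_eq ht.1 ht.2
  have hr := sqrt_arg_deriv_mem ht.1 ht.2
  have hb := hK (t - 1) ⟨by linarith [ht.1], by linarith [ht.2]⟩ q hq _ hr
  have h0 : 0 < 1 - t := by linarith [ht.2]
  have hnorm : ((1 - t) ^ 3)⁻¹ = ‖(((t : ℂ) - 1) ^ 3)⁻¹‖ := by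
    rw [norm_inv, norm_pow, ← Complex.ofReal_one, ← Complex.ofReal_sub, Complex.norm_real,
      Real.norm_eq_abs, abs_sub_comm, abs_of_pos h0]
  rw [hnorm]
  refine le_of_eq_of_le ?_ (mul_le_mul_of_nonneg_right hb (norm_nonneg _))
  rw [← norm_mul]
  congr 1
  rw [wLamDeriv, wPhaseCirc]
  generalize (2 * t - 1) / Real.sqrt (2 * t ^ 2 - 2 * t + 1) = r
  rw [hS]
  have hw : (t : ℂ) - 1 ≠ 0 := sub_ne_zero.2 (by exact_mod_cast ht.2.ne)
  push_cast
  obtain ⟨w, hwt⟩ : ∃ w : ℂ, w = (t : ℂ) - 1 := ⟨_, rfl⟩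
  have htw : (t : ℂ) = 1 + w := by rw [hwt]; ring
  rw [← hwt] at hw ⊢
  rw [htw]
  field_simp
  linear_combination hc

/-- Boundary behaviour of the bounded solution of the Levin ODE for the directional
derivative: for `y < 0`, `Φ_ℓ(τ) → (ℓ₂+iℓ₃)/(2(y+iz))` as `τ → 1⁻`, with rate `O(1-τ)`. -/
theorem wPhiL_limit_at_one (x y z l₁ l₂ l₃ : ℝ) (hy : y < 0) :
    ∃ C : ℝ, 0 ≤ C ∧ ∃ δ ∈ Set.Ioo (0 : ℝ) 1, ∀ τ ∈ Set.Ioo (1 - δ) 1,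
      ‖wPhiL τ x y z l₁ l₂ l₃ -
          ((l₂ : ℂ) + Complex.I * (l₃ : ℂ)) / (2 * ((y : ℂ) + Complex.I * (z : ℂ)))‖ ≤
        C * (1 - τ) := by
  have hyz : (y : ℂ) + Complex.I * z ≠ 0 := fun h => hy.ne (by simpa using congrArg Complex.re h)
  set c : ℂ := ((l₂ : ℂ) + Complex.I * l₃) / (2 * ((y : ℂ) + Complex.I * z)) with hcdef
  have hc : 2 * c * ((y : ℂ) + Complex.I * z) = l₂ + Complex.I * l₃ := by
    rw [hcdef]; field_simp
  obtain ⟨K, hK0, hK⟩ := exists_bound_remainder x y z l₁ l₂ l₃ c hc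
  obtain ⟨P, hP0, hP⟩ := exists_bound_wPhaseCirc l₁ l₂ l₃
  refine ⟨K / (-y), div_nonneg hK0 (by linarith), 1 / 4, ⟨by norm_num, by norm_num⟩,
    fun τ hτ => ?_⟩
  have h1 : 3 / 4 < τ := by linarith [hτ.1]
  have h2 : τ < 1 := hτ.2
  have hs : 0 < 1 - τ := by linarith
  set F : ℝ → ℂ := fun t =>
    wPhaseCirc t l₁ l₂ l₃ * Complex.exp (-(wLam t x y z)) / ((t : ℂ) - 1) ^ 4 with hF
  set R : ℝ → ℂ := fun t => Complex.exp (-(wLam t x y z)) *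
    (c * wLamDeriv t x y z * ((t : ℂ) - 1)⁻¹ + c * (((t : ℂ) - 1) ^ 2)⁻¹ -
        wPhaseCirc t l₁ l₂ l₃ / ((t : ℂ) - 1) ^ 4) with hR
  set G : ℝ → ℂ := fun t => -c * Complex.exp (-(wLam t x y z)) * ((t : ℂ) - 1)⁻¹ with hG
  have hnw : ∀ t : ℝ, t < 1 → ‖(t : ℂ) - 1‖ = 1 - t := fun t ht => by
    rw [← Complex.ofReal_one, ← Complex.ofReal_sub, Complex.norm_real,
      Real.norm_eq_abs, abs_sub_comm, abs_of_pos (by linarith)]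
  have hmE : Measurable fun t => Complex.exp (-(wLam t x y z)) := (measurable_wLam x y z).neg.cexp
  have hmP := measurable_wPhaseCirc l₁ l₂ l₃
  have hmL := measurable_wLamDeriv x y z
  have hRle : ∀ t ∈ Ioo τ 1, ‖R t‖ ≤ K * (wDecay y t * ((1 - t) ^ 3)⁻¹) := fun t ht => by
    rw [hR, norm_mul, norm_exp_neg_wLam, mul_left_comm]
    exact mul_le_mul_of_nonneg_left (hK t ⟨h1.trans ht.1, ht.2⟩) (wDecay_nonneg _ _)
  have hmR : AEStronglyMeasurable R := by
    refine Measurable.aestronglyMeasurable ?_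
    rw [hR]; fun_prop
  have hmF : AEStronglyMeasurable F := by
    refine Measurable.aestronglyMeasurable ?_
    rw [hF]; fun_prop
  have hFint : IntervalIntegrable F volume τ 1 := by
    refine intervalIntegrable_of_norm_le_wDecay hy h1 h2 hP0 hmF fun t ht => ?_
    rw [hF, norm_div, norm_mul, norm_exp_neg_wLam, norm_pow, hnw t ht.2, div_eq_mul_inv, mul_assoc]
    have h0 : 0 < 1 - t := by linarith [ht.2]
    have := wDecay_nonneg y t
    exact mul_le_mul_of_nonneg_right (hP t ⟨h1.trans ht.1, ht.2⟩) (by positivity)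
  have hRint : IntervalIntegrable R volume τ 1 := by
    refine ((intervalIntegrable_wDecay_mul hy h1 h2).const_mul K).mono_fun hmR.restrict ?_
    rw [uIoc_of_le h2.le, ← restrict_Ioo_eq_restrict_Ioc]
    refine (ae_restrict_iff' measurableSet_Ioo).2 (ae_of_all _ fun t ht => ?_)
    exact (hRle t ht).trans (le_abs_self _)
  have hGderiv : ∀ t, t ≠ 1 → HasDerivAt G (F t + R t) t := fun t ht => by
    have hw : (t : ℂ) - 1 ≠ 0 := sub_ne_zero.2 (by exact_mod_cast ht)
    have hsub : HasDerivAt (fun t : ℝ => (t : ℂ) - 1) 1 t := by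
      simpa using (hasDerivAt_id t).ofReal_comp.sub_const (1 : ℂ)
    refine (((hasDerivAt_wLam ht x y z).neg.cexp.const_mul (-c)).mul (hsub.inv hw)).congr_deriv ?_
    simp only [hF, hR, Pi.neg_apply, Pi.inv_apply]
    field_simp
    ring
  have hGlim : Tendsto G (𝓝[<] 1) (𝓝 0) := by
    rw [tendsto_zero_iff_norm_tendsto_zero]
    have h := (tendsto_wDecay_mul_inv hy).const_mul ‖c‖
    rw [mul_zero] at h
    refine h.congr' ?_
    filter_upwards [self_mem_nhdsWithin] with t ht
    rw [hG, norm_mul, norm_mul, norm_neg, norm_exp_neg_wLam, norm_inv, hnw t ht, mul_assoc]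
  have hftc := intervalIntegral.integral_eq_sub_of_hasDerivAt_of_tendsto h2 (f := G)
    (f' := fun t => F t + R t) (fun t ht => hGderiv t ht.2.ne) (hFint.add hRint)
    ((hGderiv τ h2.ne).continuousAt.tendsto.mono_left nhdsWithin_le_nhds) hGlim
  rw [intervalIntegral.integral_add hFint hRint] at hftc
  have hIF : ∫ t in τ..1, F t = -G τ - ∫ t in τ..1, R t := by linear_combination hftc
  have hIR : ‖∫ t in τ..1, R t‖ ≤ K * (wDecay y τ / (-y)) := by
    calc ‖∫ t in τ..1, R t‖ ≤ ∫ t in τ..1, ‖R t‖ :=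
          intervalIntegral.norm_integral_le_integral_norm h2.le
      _ ≤ ∫ t in τ..1, K * (wDecay y t * ((1 - t) ^ 3)⁻¹) :=
          intervalIntegral.integral_mono_on_of_le_Ioo h2.le hRint.norm
            ((intervalIntegrable_wDecay_mul hy h1 h2).const_mul K) hRle
      _ ≤ K * (wDecay y τ / (-y)) := by
          rw [intervalIntegral.integral_const_mul]
          exact mul_le_mul_of_nonneg_left (integral_wDecay_mul_le hy h1 h2) hK0
  have hw : (τ : ℂ) - 1 ≠ 0 := sub_ne_zero.2 (by exact_mod_cast h2.ne)
  have hee : Complex.exp (wLam τ x y z) * Complex.exp (-(wLam τ x y z)) = 1 := by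
    rw [← Complex.exp_add, add_neg_cancel, Complex.exp_zero]
  have hkey : wPhiL τ x y z l₁ l₂ l₃ - c =
      -(((τ : ℂ) - 1) * Complex.exp (wLam τ x y z) * ∫ t in τ..1, R t) := by
    rw [wPhiL, hIF]
    simp only [hG]
    field_simp
    linear_combination c * hee
  have hnE : ‖Complex.exp (wLam τ x y z)‖ * wDecay y τ = 1 := by
    rw [← norm_exp_neg_wLam τ x y z, ← norm_mul, hee, norm_one]
  rw [hkey, norm_neg, norm_mul, norm_mul, hnw τ h2]
  calc (1 - τ) * ‖Complex.exp (wLam τ x y z)‖ * ‖∫ t in τ..1, R t‖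
      ≤ (1 - τ) * ‖Complex.exp (wLam τ x y z)‖ * (K * (wDecay y τ / (-y))) := by gcongr
    _ = (1 - τ) * (K / (-y)) * (‖Complex.exp (wLam τ x y z)‖ * wDecay y τ) := by ring
    _ = K / (-y) * (1 - τ) := by rw [hnE]; ring
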